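/- For each k ∈ {0, 1, ..., 10}, there exists an invertible 4×4 matrix M with real entries such that the set S(M) = {(t₁, t₂, s₁, s₂) ∈ ℂ⁴ : F(t₁, t₂, s₁, s₂; M) = 0, t₁ ≠ t₂, s₁ ≠ s₂} has exactly 40 elements, the 4×4 Jacobian matrix of F(·; M) is invertible at each of them, and exactly 4k of these elements lie in ℝ⁴; i.e., the pair consisting of the standard twisted cubic and its image under M has ten common secant lines, exactly k of which are totally real. -/

import Mathlib

open Matrix

noncomputable section

/-- `v(a) = (1, a, a², a³) ∈ ℂ⁴`. -/
def tcv (a : ℂ) : Fin 4 → ℂ := ![1, a, a ^ 2, a ^ 3]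

/-- `pᵢ(s; M)`, the `i`-th coordinate of `M·v(s)`. -/
def pc (M : Matrix (Fin 4) (Fin 4) ℂ) (i : Fin 4) (s : ℂ) : ℂ := M.mulVec (tcv s) i

/-- `f₁(t₁, t₂, s; M) = p₃(s; M) − (t₁ + t₂)p₂(s; M) + t₁t₂p₁(s; M)`. -/
def f₁ (M : Matrix (Fin 4) (Fin 4) ℂ) (t₁ t₂ s : ℂ) : ℂ :=
  pc M 2 s - (t₁ + t₂) * pc M 1 s + t₁ * t₂ * pc M 0 s

/-- `f₂(t₁, t₂, s; M) = p₄(s; M) − (t₁ + t₂)p₃(s; M) + t₁t₂p₂(s; M)`. -/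
def f₂ (M : Matrix (Fin 4) (Fin 4) ℂ) (t₁ t₂ s : ℂ) : ℂ :=
  pc M 3 s - (t₁ + t₂) * pc M 2 s + t₁ * t₂ * pc M 1 s

/-- The square polynomial system `F(·; M)` viewed as a map `ℂ⁴ → ℂ⁴`, with the
variables ordered `(t₁, t₂, s₁, s₂)`. -/
def Fmap (M : Matrix (Fin 4) (Fin 4) ℂ) (x : Fin 4 → ℂ) : Fin 4 → ℂ :=
  ![f₁ M (x 0) (x 1) (x 2), f₁ M (x 0) (x 1) (x 3),
    f₂ M (x 0) (x 1) (x 2), f₂ M (x 0) (x 1) (x 3)]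

/-- `S(M)`: solutions of `F(·; M) = 0` with `t₁ ≠ t₂` and `s₁ ≠ s₂`. -/
def Ssol (M : Matrix (Fin 4) (Fin 4) ℂ) : Set (Fin 4 → ℂ) :=
  {x | Fmap M x = 0 ∧ x 0 ≠ x 1 ∧ x 2 ≠ x 3}

/-- The 4×4 Jacobian matrix of `F(·; M)` with respect to `(t₁, t₂, s₁, s₂)`. -/
def Jac (M : Matrix (Fin 4) (Fin 4) ℂ) (x : Fin 4 → ℂ) : Matrix (Fin 4) (Fin 4) ℂ :=
  fun i j => deriv (fun z => Fmap M (Function.update x j z) i) (x j)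

/-- A real matrix viewed as a complex matrix. -/
def cm (M : Matrix (Fin 4) (Fin 4) ℝ) : Matrix (Fin 4) (Fin 4) ℂ :=
  M.map Complex.ofReal

/-- The matrices commuting with the action of `s ↦ -s` on the twisted cubic, normalised so that
the entry in position `(2, 4)` is `1`. -/
def evenMat (a b c e f g h : ℝ) : Matrix (Fin 4) (Fin 4) ℝ :=
  !![a, 0, b, 0; 0, c, 0, 1; e, 0, f, 0; 0, g, 0, h]

/-- The condition that, for `M = evenMat a b c e f g h`, both cubics `f₁(t₁, t₂, ·; M)` and
`f₂(t₁, t₂, ·; M)` with `t₁ + t₂ = p`, `t₁t₂ = q` are divisible by `s² - us + v`. -/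
def IsCommonSecant (a b c e f g h p q u v : ℂ) : Prop :=
  e + q * a - (f + q * b) * v + p * u * v = 0 ∧
  -p * c + (f + q * b) * u - p * (u ^ 2 - v) = 0 ∧
  -p * e + p * f * v - (h + q) * u * v = 0 ∧
  g + q * c - p * f * u + (h + q) * (u ^ 2 - v) = 0

lemma f₁_evenMat (a b c e f g h : ℝ) (t₁ t₂ s : ℂ) :
    f₁ (cm (evenMat a b c e f g h)) t₁ t₂ s =
      e + f * s ^ 2 - (t₁ + t₂) * (c * s + s ^ 3) + t₁ * t₂ * (a + b * s ^ 2) := by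
  simp [f₁, pc, cm, evenMat, tcv, Matrix.mulVec, dotProduct, Fin.sum_univ_four]

lemma f₂_evenMat (a b c e f g h : ℝ) (t₁ t₂ s : ℂ) :
    f₂ (cm (evenMat a b c e f g h)) t₁ t₂ s =
      g * s + h * s ^ 3 - (t₁ + t₂) * (e + f * s ^ 2) + t₁ * t₂ * (c * s + s ^ 3) := by
  simp [f₂, pc, cm, evenMat, tcv, Matrix.mulVec, dotProduct, Fin.sum_univ_four]

lemma linear_eq_zero_of_two_roots {α β s₁ s₂ : ℂ} (hs : s₁ ≠ s₂) (h₁ : α + β * s₁ = 0)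
    (h₂ : α + β * s₂ = 0) : α = 0 ∧ β = 0 := by
  have hβ : β = 0 := by
    have : β * (s₁ - s₂) = 0 := by linear_combination h₁ - h₂
    exact (mul_eq_zero.mp this).resolve_right (sub_ne_zero.mpr hs)
  subst hβ
  exact ⟨by simpa using h₁, rfl⟩

lemma mem_Ssol_evenMat (a b c e f g h : ℝ) (x : Fin 4 → ℂ) :
    x ∈ Ssol (cm (evenMat a b c e f g h)) ↔
      IsCommonSecant a b c e f g h (x 0 + x 1) (x 0 * x 1) (x 2 + x 3) (x 2 * x 3) ∧
        x 0 ≠ x 1 ∧ x 2 ≠ x 3 := by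
  refine and_congr_left fun ⟨_, hs⟩ => ?_
  have hF : Fmap (cm (evenMat a b c e f g h)) x = 0 ↔
      f₁ (cm (evenMat a b c e f g h)) (x 0) (x 1) (x 2) = 0 ∧
      f₁ (cm (evenMat a b c e f g h)) (x 0) (x 1) (x 3) = 0 ∧
      f₂ (cm (evenMat a b c e f g h)) (x 0) (x 1) (x 2) = 0 ∧
      f₂ (cm (evenMat a b c e f g h)) (x 0) (x 1) (x 3) = 0 := by
    simp [funext_iff, Fin.forall_fin_succ, Fmap]
  rw [hF]
  simp only [f₁_evenMat, f₂_evenMat]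
  constructor
  · rintro ⟨h₁, h₂, h₃, h₄⟩
    obtain ⟨h₁, h₂⟩ := linear_eq_zero_of_two_roots hs
      (α := e + x 0 * x 1 * a - (f + x 0 * x 1 * b) * (x 2 * x 3)
        + (x 0 + x 1) * (x 2 + x 3) * (x 2 * x 3))
      (β := -(x 0 + x 1) * c + (f + x 0 * x 1 * b) * (x 2 + x 3)
        - (x 0 + x 1) * ((x 2 + x 3) ^ 2 - x 2 * x 3))
      (by linear_combination h₁) (by linear_combination h₂)
    obtain ⟨h₃, h₄⟩ := linear_eq_zero_of_two_roots hs
      (α := -(x 0 + x 1) * e + (x 0 + x 1) * f * (x 2 * x 3)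
        - (h + x 0 * x 1) * (x 2 + x 3) * (x 2 * x 3))
      (β := g + x 0 * x 1 * c - (x 0 + x 1) * f * (x 2 + x 3)
        + (h + x 0 * x 1) * ((x 2 + x 3) ^ 2 - x 2 * x 3))
      (by linear_combination h₃) (by linear_combination h₄)
    exact ⟨h₁, h₂, h₃, h₄⟩
  · rintro ⟨h₁, h₂, h₃, h₄⟩
    exact ⟨by linear_combination h₁ + x 2 * h₂, by linear_combination h₁ + x 3 * h₂,
      by linear_combination h₃ + x 2 * h₄, by linear_combination h₃ + x 3 * h₄⟩

/-- The Jacobian matrix of the four polynomials in `IsCommonSecant` with respect to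
`(p, q, u, v)`. -/
def secantJac (a b c e f h p q u v : ℂ) : Matrix (Fin 4) (Fin 4) ℂ :=
  !![u * v, a - b * v, p * v, -(f + q * b) + p * u;
    -c - (u ^ 2 - v), b * u, f + q * b - 2 * p * u, p;
    -e + f * v, -u * v, -(h + q) * v, p * f - (h + q) * u;
    -f * u, c + (u ^ 2 - v), -p * f + 2 * (h + q) * u, -(h + q)]

lemma deriv_cubic (α β γ δ x : ℂ) :
    deriv (fun z => α + β * z + γ * z ^ 2 + δ * z ^ 3) x = β + 2 * γ * x + 3 * δ * x ^ 2 := by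
  have h := ((((hasDerivAt_id' x).const_mul β).const_add α).add
    (((hasDerivAt_id' x).pow 2).const_mul γ)).add (((hasDerivAt_id' x).pow 3).const_mul δ)
  have h' : HasDerivAt (fun z => α + β * z + γ * z ^ 2 + δ * z ^ 3)
      (β + 2 * γ * x + 3 * δ * x ^ 2) x := by
    refine HasDerivAt.congr_deriv h ?_
    simp
    ring
  exact h'.deriv

lemma deriv_eq_of_cubic {F : ℂ → ℂ} {α β γ δ x y : ℂ}
    (hF : ∀ z, F z = α + β * z + γ * z ^ 2 + δ * z ^ 3)
    (hy : y = β + 2 * γ * x + 3 * δ * x ^ 2) : deriv F x = y := by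
  rw [funext hF, deriv_cubic, hy]

lemma Jac_evenMat (a b c e f g h : ℝ) (x : Fin 4 → ℂ) :
    Jac (cm (evenMat a b c e f g h)) x =
      !![-(c * x 2 + x 2 ^ 3) + x 1 * (a + b * x 2 ^ 2),
        -(c * x 2 + x 2 ^ 3) + x 0 * (a + b * x 2 ^ 2),
        2 * f * x 2 - (x 0 + x 1) * (c + 3 * x 2 ^ 2) + x 0 * x 1 * (2 * b * x 2), 0;
        -(c * x 3 + x 3 ^ 3) + x 1 * (a + b * x 3 ^ 2),
        -(c * x 3 + x 3 ^ 3) + x 0 * (a + b * x 3 ^ 2), 0,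
        2 * f * x 3 - (x 0 + x 1) * (c + 3 * x 3 ^ 2) + x 0 * x 1 * (2 * b * x 3);
        -(e + f * x 2 ^ 2) + x 1 * (c * x 2 + x 2 ^ 3),
        -(e + f * x 2 ^ 2) + x 0 * (c * x 2 + x 2 ^ 3),
        g + 3 * h * x 2 ^ 2 - (x 0 + x 1) * (2 * f * x 2) + x 0 * x 1 * (c + 3 * x 2 ^ 2), 0;
        -(e + f * x 3 ^ 2) + x 1 * (c * x 3 + x 3 ^ 3),
        -(e + f * x 3 ^ 2) + x 0 * (c * x 3 + x 3 ^ 3), 0,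
        g + 3 * h * x 3 ^ 2 - (x 0 + x 1) * (2 * f * x 3)
          + x 0 * x 1 * (c + 3 * x 3 ^ 2)] := by
  have d₁ (t s w : ℂ) : deriv (fun z => f₁ (cm (evenMat a b c e f g h)) z t s) w =
      -(c * s + s ^ 3) + t * (a + b * s ^ 2) :=
    deriv_eq_of_cubic (α := e + f * s ^ 2 - t * (c * s + s ^ 3))
      (β := -(c * s + s ^ 3) + t * (a + b * s ^ 2)) (γ := 0) (δ := 0)
      (fun z => by rw [f₁_evenMat]; ring) (by ring)
  have d₂ (t s w : ℂ) : deriv (fun z => f₁ (cm (evenMat a b c e f g h)) t z s) w =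
      -(c * s + s ^ 3) + t * (a + b * s ^ 2) :=
    deriv_eq_of_cubic (α := e + f * s ^ 2 - t * (c * s + s ^ 3))
      (β := -(c * s + s ^ 3) + t * (a + b * s ^ 2)) (γ := 0) (δ := 0)
      (fun z => by rw [f₁_evenMat]; ring) (by ring)
  have d₃ (t t' w : ℂ) : deriv (fun z => f₁ (cm (evenMat a b c e f g h)) t t' z) w =
      2 * f * w - (t + t') * (c + 3 * w ^ 2) + t * t' * (2 * b * w) :=
    deriv_eq_of_cubic (α := e + t * t' * a) (β := -(t + t') * c)
      (γ := f + t * t' * b) (δ := -(t + t'))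
      (fun z => by rw [f₁_evenMat]; ring) (by ring)
  have d₄ (t s w : ℂ) : deriv (fun z => f₂ (cm (evenMat a b c e f g h)) z t s) w =
      -(e + f * s ^ 2) + t * (c * s + s ^ 3) :=
    deriv_eq_of_cubic (α := g * s + h * s ^ 3 - t * (e + f * s ^ 2))
      (β := -(e + f * s ^ 2) + t * (c * s + s ^ 3)) (γ := 0) (δ := 0)
      (fun z => by rw [f₂_evenMat]; ring) (by ring)
  have d₅ (t s w : ℂ) : deriv (fun z => f₂ (cm (evenMat a b c e f g h)) t z s) w =
      -(e + f * s ^ 2) + t * (c * s + s ^ 3) :=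
    deriv_eq_of_cubic (α := g * s + h * s ^ 3 - t * (e + f * s ^ 2))
      (β := -(e + f * s ^ 2) + t * (c * s + s ^ 3)) (γ := 0) (δ := 0)
      (fun z => by rw [f₂_evenMat]; ring) (by ring)
  have d₆ (t t' w : ℂ) : deriv (fun z => f₂ (cm (evenMat a b c e f g h)) t t' z) w =
      g + 3 * h * w ^ 2 - (t + t') * (2 * f * w) + t * t' * (c + 3 * w ^ 2) :=
    deriv_eq_of_cubic (α := -(t + t') * e) (β := g + t * t' * c)
      (γ := -(t + t') * f) (δ := h + t * t')
      (fun z => by rw [f₂_evenMat]; ring) (by ring)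
  ext i j
  fin_cases i <;> fin_cases j <;> simp [Jac, Fmap, d₁, d₂, d₃, d₄, d₅, d₆]

lemma Jac_evenMat_eq_mul {a b c e f g h : ℝ} {x : Fin 4 → ℂ}
    (hx : IsCommonSecant a b c e f g h (x 0 + x 1) (x 0 * x 1) (x 2 + x 3) (x 2 * x 3)) :
    Jac (cm (evenMat a b c e f g h)) x =
      !![1, x 2, 0, 0; 1, x 3, 0, 0; 0, 0, 1, x 2; 0, 0, 1, x 3] *
      secantJac a b c e f h (x 0 + x 1) (x 0 * x 1) (x 2 + x 3) (x 2 * x 3) *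
      !![1, 1, 0, 0; x 1, x 0, 0, 0; 0, 0, 1, 1; 0, 0, x 3, x 2] := by
  obtain ⟨-, h₂, -, h₄⟩ := hx
  rw [Jac_evenMat, secantJac]
  ext i j
  fin_cases i <;> fin_cases j <;>
    simp [Matrix.mul_apply, Fin.sum_univ_four]
  all_goals first
    | ring1
    | linear_combination h₂
    | linear_combination h₄

lemma isUnit_Jac_evenMat {a b c e f g h : ℝ} {x : Fin 4 → ℂ}
    (hx : IsCommonSecant a b c e f g h (x 0 + x 1) (x 0 * x 1) (x 2 + x 3) (x 2 * x 3))
    (ht : x 0 ≠ x 1) (hs : x 2 ≠ x 3)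
    (hdet : (secantJac a b c e f h (x 0 + x 1) (x 0 * x 1) (x 2 + x 3) (x 2 * x 3)).det ≠ 0) :
    IsUnit (Jac (cm (evenMat a b c e f g h)) x) := by
  have h₁ : (!![1, x 2, 0, 0; 1, x 3, 0, 0; 0, 0, 1, x 2; 0, 0, 1, x 3] :
      Matrix (Fin 4) (Fin 4) ℂ).det = (x 2 - x 3) ^ 2 := by
    simp [Matrix.det_succ_row_zero, Fin.sum_univ_succ, Fin.succAbove]
    ring
  have h₂ : (!![1, 1, 0, 0; x 1, x 0, 0, 0; 0, 0, 1, 1; 0, 0, x 3, x 2] :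
      Matrix (Fin 4) (Fin 4) ℂ).det = (x 0 - x 1) * (x 2 - x 3) := by
    simp [Matrix.det_succ_row_zero, Fin.sum_univ_succ, Fin.succAbove]
    ring
  rw [Matrix.isUnit_iff_isUnit_det, Jac_evenMat_eq_mul hx, Matrix.det_mul, Matrix.det_mul, h₁, h₂,
    isUnit_iff_ne_zero]
  have := sub_ne_zero.mpr ht
  have := sub_ne_zero.mpr hs
  positivity

/-- Laplace expansion of a `4 × 4` determinant along the first two rows. -/
lemma det_fin_four_of {K : Type*} [CommRing K]
    (a₁ a₂ a₃ a₄ b₁ b₂ b₃ b₄ c₁ c₂ c₃ c₄ d₁ d₂ d₃ d₄ : K) :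
    (!![a₁, a₂, a₃, a₄; b₁, b₂, b₃, b₄; c₁, c₂, c₃, c₄; d₁, d₂, d₃, d₄]).det =
      (a₁ * b₂ - a₂ * b₁) * (c₃ * d₄ - c₄ * d₃) - (a₁ * b₃ - a₃ * b₁) * (c₂ * d₄ - c₄ * d₂) +
      (a₁ * b₄ - a₄ * b₁) * (c₂ * d₃ - c₃ * d₂) + (a₂ * b₃ - a₃ * b₂) * (c₁ * d₄ - c₄ * d₁) -
      (a₂ * b₄ - a₄ * b₂) * (c₁ * d₃ - c₃ * d₁) + (a₃ * b₄ - a₄ * b₃) * (c₁ * d₂ - c₂ * d₁) := by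
  simp [Matrix.det_succ_row_zero, Fin.sum_univ_succ, Fin.succAbove]
  ring

/-- For `p ≠ 0`, this matrix is `secantJac` at `(p, q, r * p, v)` with `p ^ 2 = w`, after scaling
rows and columns by powers of `p`. -/
def pairJac {K : Type*} [CommRing K] (a b c e f h q v r w : K) : Matrix (Fin 4) (Fin 4) K :=
  !![r * w * v, a - b * v, w * v, -(f + q * b) + r * w;
    -c - (r ^ 2 * w - v), b * r, f + q * b - 2 * (r * w), 1;
    -e + f * v, -r * v, -(h + q) * v, f - (h + q) * r;
    -f * (r * w), c + (r ^ 2 * w - v), -w * f + 2 * (h + q) * (r * w), -(h + q)]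

lemma det_pairJac_ofReal (a b c e f h q v r w : ℝ) :
    (pairJac (a : ℂ) b c e f h q v r w).det = ((pairJac a b c e f h q v r w).det : ℝ) := by
  refine Eq.trans (congrArg Matrix.det ?_) (RingHom.map_det Complex.ofRealHom _).symm
  ext i j
  fin_cases i <;> fin_cases j <;> simp [pairJac]

lemma det_secantJac {p w : ℂ} (hp : p ^ 2 = w) (hw : w ≠ 0) (a b c e f h q v r : ℂ) :
    (secantJac a b c e f h p q (r * p) v).det = (pairJac a b c e f h q v r w).det := by
  have hmul : secantJac a b c e f h p q (r * p) v * Matrix.diagonal ![p, 1, p, 1] =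
      Matrix.diagonal ![1, p, p, 1] * pairJac a b c e f h q v r w := by
    subst hp
    ext i j
    fin_cases i <;> fin_cases j <;> simp [secantJac, pairJac] <;> ring
  have hd := congrArg Matrix.det hmul
  simp only [Matrix.det_mul, Matrix.det_diagonal, Fin.prod_univ_four] at hd
  refine mul_right_cancel₀ hw ?_
  simp at hd
  linear_combination hd + ((pairJac a b c e f h q v r w).det -
    (secantJac a b c e f h p q (r * p) v).det) * hp

/-- A complex square root. -/
def csqrt (x : ℂ) : ℂ := x ^ ((2 : ℕ) : ℂ)⁻¹

lemma csqrt_sq (x : ℂ) : csqrt x ^ 2 = x := Complex.cpow_nat_inv_pow x two_ne_zero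

lemma csqrt_ne_zero {x : ℂ} (hx : x ≠ 0) : csqrt x ≠ 0 := by
  intro h
  exact hx (by rw [← csqrt_sq x, h, zero_pow two_ne_zero])

/-- The sign `1` or `-1`. -/
def sgn (ε : Bool) : ℂ := if ε then 1 else -1

lemma sgn_sq (ε : Bool) : sgn ε ^ 2 = 1 := by cases ε <;> simp [sgn]

lemma sgn_mul_csqrt_sq (ε : Bool) (x : ℂ) : (sgn ε * csqrt x) ^ 2 = x := by
  rw [mul_pow, sgn_sq, csqrt_sq, one_mul]

lemma sgn_mul_csqrt_ne_zero (ε : Bool) {x : ℂ} (hx : x ≠ 0) : sgn ε * csqrt x ≠ 0 := by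
  intro h
  exact hx (by rw [← sgn_mul_csqrt_sq ε x, h, zero_pow two_ne_zero])

lemma sgn_injective : Function.Injective sgn := by
  have h : (1 : ℂ) ≠ -1 := by norm_num
  rintro (_ | _) (_ | _) hab
  · rfl
  · exact absurd hab.symm (by simpa [sgn] using h)
  · exact absurd hab (by simpa [sgn] using h)
  · rfl

lemma sgn_mul_csqrt_inj {ε ε' : Bool} {x : ℂ} (hx : x ≠ 0)
    (h : sgn ε * csqrt x = sgn ε' * csqrt x) : ε = ε' :=
  sgn_injective (mul_right_cancel₀ (csqrt_ne_zero hx) h)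

lemma exists_eq_sgn_mul_csqrt {t x : ℂ} (h : t ^ 2 = x) : ∃ ε, sgn ε * csqrt x = t := by
  rw [← csqrt_sq x, sq_eq_sq_iff_eq_or_eq_neg] at h
  obtain h | h := h
  · exact ⟨true, by simp [sgn, h]⟩
  · exact ⟨false, by simp [sgn, h]⟩

lemma im_eq_zero_iff_of_sq_eq {t : ℂ} {x : ℝ} (hx : x ≠ 0) (h : t ^ 2 = x) :
    t.im = 0 ↔ 0 < x := by
  have hre : t.re * t.re - t.im * t.im = x := by simpa [sq] using congrArg Complex.re h
  have him : t.re * t.im + t.im * t.re = 0 := by simpa [sq] using congrArg Complex.im h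
  constructor
  · intro h0
    rw [h0] at hre
    exact lt_of_le_of_ne (by nlinarith [mul_self_nonneg t.re]) hx.symm
  · intro hpos
    by_contra h0
    have : t.re = 0 := by
      refine (mul_eq_zero.mp (?_ : t.im * t.re = 0)).resolve_left h0
      linarith
    rw [this] at hre
    nlinarith [mul_self_nonneg t.im]

/-- The point `(t₁, t₂, s₁, s₂)` with `t₁ + t₂ = p`, `t₁ - t₂ = δ`, `s₁ + s₂ = u` and
`s₁ - s₂ = η`. -/
def pointOf (p δ u η : ℂ) : Fin 4 → ℂ := ![(p + δ) / 2, (p - δ) / 2, (u + η) / 2, (u - η) / 2]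

lemma pointOf_eq_iff {p δ u η : ℂ} {x : Fin 4 → ℂ} :
    pointOf p δ u η = x ↔ p = x 0 + x 1 ∧ δ = x 0 - x 1 ∧ u = x 2 + x 3 ∧ η = x 2 - x 3 := by
  constructor
  · rintro rfl
    simp only [pointOf, Matrix.cons_val]
    refine ⟨?_, ?_, ?_, ?_⟩ <;> ring
  · rintro ⟨rfl, rfl, rfl, rfl⟩
    ext i
    fin_cases i <;> simp [pointOf]

lemma pointOf_inj {p δ u η p' δ' u' η' : ℂ} (h : pointOf p δ u η = pointOf p' δ' u' η') :
    p = p' ∧ δ = δ' ∧ u = u' ∧ η = η' := by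
  obtain ⟨h₁, h₂, h₃, h₄⟩ := pointOf_eq_iff.mp (rfl : pointOf p' δ' u' η' = _)
  obtain ⟨k₁, k₂, k₃, k₄⟩ := pointOf_eq_iff.mp h
  exact ⟨k₁.trans h₁.symm, k₂.trans h₂.symm, k₃.trans h₃.symm, k₄.trans h₄.symm⟩

lemma im_pointOf {p δ u η : ℂ} :
    (∀ i, (pointOf p δ u η i).im = 0) ↔ (p.im = 0 ∧ δ.im = 0) ∧ u.im = 0 ∧ η.im = 0 := by
  have h2 (z : ℂ) : (z / 2).im = z.im / 2 := by simp
  simp only [Fin.forall_fin_succ, pointOf, Matrix.cons_val, h2, Complex.add_im]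
  simp [h2]
  constructor
  · rintro ⟨h₁, h₂, h₃, h₄⟩
    refine ⟨⟨?_, ?_⟩, ?_, ?_⟩ <;> linarith
  · rintro ⟨⟨h₁, h₂⟩, h₃, h₄⟩
    simp [h₁, h₂, h₃, h₄]


/-- A real matrix `evenMat a b c e f g h` whose ten common secants, in the symmetric
coordinates `(p, q, u, v)` of `IsCommonSecant`, are the two points `(0, n i, 0, z i)` fixed by
`s ↦ -s` and the four pairs `(p, ρ y i, r i p, y i)` with `p ^ 2 = w i`. -/
structure SymmetricSecants where
  (a b c e f g h ρ : ℝ)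
  (y r w : Fin 4 → ℝ)
  (z n : Fin 2 → ℝ)
  e_ne : e ≠ 0
  ρ_ne : ρ ≠ 0
  minor_ne : a * f - e * b ≠ 0
  minor_ne' : g * a - e * c ≠ 0
  minor_eq : h * c - g = ρ * (a * f - e * b)
  vieta₁ : h - ρ * c = -ρ * (y 0 + y 1 + y 2 + y 3)
  vieta₂ : ρ * a * f - h * c =
    ρ * (y 0 * y 1 + y 0 * y 2 + y 0 * y 3 + y 1 * y 2 + y 1 * y 3 + y 2 * y 3)
  vieta₃ : e * f - ρ * a * e =
    -ρ * (y 0 * y 1 * y 2 + y 0 * y 1 * y 3 + y 0 * y 2 * y 3 + y 1 * y 2 * y 3)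
  vieta₄ : -e ^ 2 = ρ * (y 0 * y 1 * y 2 * y 3)
  lead_ne : h * b - f ≠ 0
  vieta_sum : f * c + e - h * a - g * b = -(h * b - f) * (z 0 + z 1)
  vieta_prod : g * a - e * c = (h * b - f) * (z 0 * z 1)
  y_inj : Function.Injective y
  z_inj : Function.Injective z
  y_ne : ∀ i, y i ≠ 0
  r_ne : ∀ i, r i ≠ 0
  w_ne : ∀ i, w i ≠ 0
  z_ne : ∀ i, z i ≠ 0
  n_ne : ∀ i, n i ≠ 0
  h_add_ne : ∀ i, h + ρ * y i ≠ 0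
  disc_t : ∀ i, w i - 4 * (ρ * y i) ≠ 0
  disc_s : ∀ i, r i ^ 2 * w i - 4 * y i ≠ 0
  pair₁ : ∀ i, e + ρ * y i * a - (f + ρ * y i * b) * y i + r i * w i * y i = 0
  pair₂ : ∀ i, -c + (f + ρ * y i * b) * r i - (r i ^ 2 * w i - y i) = 0
  pair₃ : ∀ i, -e + f * y i - (h + ρ * y i) * r i * y i = 0
  pair₄ : ∀ i, g + ρ * y i * c - f * r i * w i + (h + ρ * y i) * (r i ^ 2 * w i - y i) = 0
  fixed₁ : ∀ i, e + n i * a - (f + n i * b) * z i = 0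
  fixed₂ : ∀ i, g + n i * c - (h + n i) * z i = 0
  jac_pair : ∀ i, (pairJac a b c e f h (ρ * y i) (y i) (r i) (w i)).det ≠ 0
  jac_fixed₁ : ∀ i, (f + n i * b) * (c - z i) - (a - b * z i) * (h + n i) ≠ 0
  jac_fixed₂ : ∀ i, (c - z i) * (h + n i) * z i - (f + n i * b) * (f * z i - e) ≠ 0

namespace SymmetricSecants

variable (S : SymmetricSecants)

/-- The underlying matrix. -/
def mat : Matrix (Fin 4) (Fin 4) ℝ := evenMat S.a S.b S.c S.e S.f S.g S.h

lemma isUnit_det_mat : IsUnit S.mat.det := by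
  have hd : S.mat.det = (S.a * S.f - S.e * S.b) * (S.h * S.c - S.g) := by
    simp [mat, evenMat, Matrix.det_succ_row_zero, Fin.sum_univ_succ, Fin.succAbove]
    ring
  rw [hd, S.minor_eq, isUnit_iff_ne_zero]
  exact mul_ne_zero S.minor_ne (mul_ne_zero S.ρ_ne S.minor_ne)

/-- The common secants of `S`, in symmetric coordinates. -/
def IsListed (p q u v : ℂ) : Prop :=
  (∃ i, p ^ 2 = S.w i ∧ q = S.ρ * S.y i ∧ u = S.r i * p ∧ v = S.y i) ∨
  ∃ i, p = 0 ∧ q = S.n i ∧ u = 0 ∧ v = S.z i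

variable {S} in
lemma IsListed.isCommonSecant {p q u v : ℂ} (hl : S.IsListed p q u v) :
    IsCommonSecant S.a S.b S.c S.e S.f S.g S.h p q u v := by
  obtain ⟨i, hp, rfl, rfl, rfl⟩ | ⟨i, rfl, rfl, rfl, rfl⟩ := hl
  · have h₁ := congrArg Complex.ofReal (S.pair₁ i)
    have h₂ := congrArg Complex.ofReal (S.pair₂ i)
    have h₃ := congrArg Complex.ofReal (S.pair₃ i)
    have h₄ := congrArg Complex.ofReal (S.pair₄ i)
    push_cast at h₁ h₂ h₃ h₄
    refine ⟨?_, ?_, ?_, ?_⟩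
    · linear_combination h₁ + S.r i * S.y i * hp
    · linear_combination p * h₂ - p * S.r i ^ 2 * hp
    · linear_combination p * h₃
    · linear_combination h₄ + (-S.f * S.r i + (S.h + S.ρ * S.y i) * S.r i ^ 2) * hp
  · have h₁ := congrArg Complex.ofReal (S.fixed₁ i)
    have h₂ := congrArg Complex.ofReal (S.fixed₂ i)
    push_cast at h₁ h₂
    refine ⟨?_, ?_, ?_, ?_⟩
    · linear_combination h₁
    · ring
    · ring
    · linear_combination h₂

lemma minor_ne_complex : (S.a * S.f - S.e * S.b : ℂ) ≠ 0 := mod_cast S.minor_ne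

lemma isListed_of_isCommonSecant_zero {q v : ℂ}
    (h₁ : (S.e : ℂ) + q * S.a - (S.f + q * S.b) * v = 0)
    (h₂ : (S.g : ℂ) + q * S.c - (S.h + q) * v = 0) : S.IsListed 0 q 0 v := by
  refine Or.inr ?_
  have hl : (S.h * S.b - S.f : ℂ) ≠ 0 := mod_cast S.lead_ne
  have hs := congrArg Complex.ofReal S.vieta_sum
  have hp := congrArg Complex.ofReal S.vieta_prod
  push_cast at hs hp
  have hv : ∃ i, v = S.z i := by
    have : (S.h * S.b - S.f : ℂ) * ((v - S.z 0) * (v - S.z 1)) = 0 := by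
      linear_combination (S.a - S.b * v) * h₂ - (S.c - v) * h₁ - v * hs - hp
    obtain h | h := mul_eq_zero.mp ((mul_eq_zero.mp this).resolve_left hl)
    exacts [⟨0, sub_eq_zero.mp h⟩, ⟨1, sub_eq_zero.mp h⟩]
  obtain ⟨i, rfl⟩ := hv
  refine ⟨i, rfl, ?_, rfl, rfl⟩
  have hf := congrArg Complex.ofReal (S.fixed₁ i)
  push_cast at hf
  have : (q - S.n i) * (S.a - S.b * S.z i) = 0 := by linear_combination h₁ - hf
  refine sub_eq_zero.mp ((mul_eq_zero.mp this).resolve_right fun h0 => S.minor_ne_complex ?_)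
  linear_combination S.f * h0 - S.b * h₁ + q * S.b * h0

lemma isListed_of_isCommonSecant_ne {p q u v : ℂ} (hp : p ≠ 0) (hv : v ≠ 0)
    (hx : IsCommonSecant S.a S.b S.c S.e S.f S.g S.h p q u v) : S.IsListed p q u v := by
  obtain ⟨h₁, h₂, h₃, h₄⟩ := hx
  refine Or.inl ?_
  have hE₁ : ((S.f : ℂ) * v - S.e) * (S.e + q * S.a) - (S.h + q) * v ^ 2 * (S.c - v) = 0 := by
    refine (mul_eq_zero.mp (?_ : p * _ = 0)).resolve_left hp
    linear_combination (S.e + q * S.a) * h₃ + u * v * (S.h + q) * h₁ + (S.h + q) * v ^ 2 * h₂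
  have hE₂ : ((S.g : ℂ) + q * S.c) * v ^ 2 - S.e * ((S.f + q * S.b) * v - (S.e + q * S.a))
      - (S.h + q) * v ^ 3 = 0 := by
    linear_combination v ^ 2 * h₄ + v * u * h₃ + S.e * h₁
  have hm := congrArg Complex.ofReal S.minor_eq
  push_cast at hm
  have hq : q = S.ρ * v := by
    have : v * ((S.a * S.f - S.e * S.b : ℂ) * (q - S.ρ * v)) = 0 := by
      linear_combination hE₁ + hE₂ + v ^ 2 * hm
    exact sub_eq_zero.mp
      ((mul_eq_zero.mp ((mul_eq_zero.mp this).resolve_left hv)).resolve_left S.minor_ne_complex)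
  subst hq
  have hy : ∃ i, v = S.y i := by
    have v₁ := congrArg Complex.ofReal S.vieta₁
    have v₂ := congrArg Complex.ofReal S.vieta₂
    have v₃ := congrArg Complex.ofReal S.vieta₃
    have v₄ := congrArg Complex.ofReal S.vieta₄
    push_cast at v₁ v₂ v₃ v₄
    have : (S.ρ : ℂ) * ((v - S.y 0) * ((v - S.y 1) * ((v - S.y 2) * (v - S.y 3)))) = 0 := by
      linear_combination hE₁ - v ^ 3 * v₁ - v ^ 2 * v₂ - v * v₃ - v₄
    have := (mul_eq_zero.mp this).resolve_left (mod_cast S.ρ_ne)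
    simp only [mul_eq_zero, sub_eq_zero] at this
    obtain h | h | h | h := this
    exacts [⟨0, h⟩, ⟨1, h⟩, ⟨2, h⟩, ⟨3, h⟩]
  obtain ⟨i, rfl⟩ := hy
  have k₁ := congrArg Complex.ofReal (S.pair₁ i)
  have k₃ := congrArg Complex.ofReal (S.pair₃ i)
  push_cast at k₁ k₃
  have hH : (S.h + S.ρ * S.y i : ℂ) ≠ 0 := mod_cast S.h_add_ne i
  have hu : u = S.r i * p := by
    have : (S.h + S.ρ * S.y i : ℂ) * (S.y i * (u - S.r i * p)) = 0 := by
      linear_combination p * k₃ - h₃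
    exact sub_eq_zero.mp
      ((mul_eq_zero.mp ((mul_eq_zero.mp this).resolve_left hH)).resolve_left hv)
  refine ⟨i, ?_, rfl, hu, rfl⟩
  subst hu
  have hr : (S.r i : ℂ) ≠ 0 := mod_cast S.r_ne i
  have : (S.y i : ℂ) * (S.r i * (p ^ 2 - S.w i)) = 0 := by linear_combination h₁ - k₁
  exact sub_eq_zero.mp
    ((mul_eq_zero.mp ((mul_eq_zero.mp this).resolve_left hv)).resolve_left hr)

theorem isCommonSecant_iff {p q u v : ℂ} :
    IsCommonSecant S.a S.b S.c S.e S.f S.g S.h p q u v ↔ S.IsListed p q u v := by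
  refine ⟨fun hx => ?_, IsListed.isCommonSecant⟩
  by_cases hp : p = 0
  · subst hp
    obtain ⟨h₁, h₂, h₃, h₄⟩ := hx
    have hu : u = 0 := by
      by_contra hu
      have hB : (S.f : ℂ) + q * S.b = 0 :=
        (mul_eq_zero.mp (by linear_combination h₂ : _ * u = 0)).resolve_right hu
      refine S.minor_ne_complex ?_
      linear_combination S.a * hB - S.b * h₁ - S.b * v * hB
    subst hu
    exact S.isListed_of_isCommonSecant_zero (by linear_combination h₁) (by linear_combination h₄)
  by_cases hv : v = 0
  · subst hv
    obtain ⟨-, -, h₃, -⟩ := hx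
    have he : (S.e : ℂ) ≠ 0 := mod_cast S.e_ne
    exact absurd (by linear_combination -h₃ : p * S.e = 0) (mul_ne_zero hp he)
  · exact S.isListed_of_isCommonSecant_ne hp hv hx

lemma secantJac_det_ne_zero {p q u v : ℂ} (hl : S.IsListed p q u v) :
    (secantJac S.a S.b S.c S.e S.f S.h p q u v).det ≠ 0 := by
  obtain ⟨i, hp, rfl, rfl, rfl⟩ | ⟨i, rfl, rfl, rfl, rfl⟩ := hl
  · rw [det_secantJac hp (mod_cast S.w_ne i)]
    have hd := det_pairJac_ofReal S.a S.b S.c S.e S.f S.h (S.ρ * S.y i) (S.y i) (S.r i) (S.w i)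
    push_cast at hd
    rw [hd]
    exact mod_cast S.jac_pair i
  · have hd : (secantJac S.a S.b S.c S.e S.f S.h 0 (S.n i) 0 (S.z i)).det =
        (-((S.f + S.n i * S.b) * (S.c - S.z i) - (S.a - S.b * S.z i) * (S.h + S.n i)) *
        ((S.c - S.z i) * (S.h + S.n i) * S.z i
          - (S.f + S.n i * S.b) * (S.f * S.z i - S.e)) : ℝ) := by
      simp [secantJac, Matrix.det_succ_row_zero, Fin.sum_univ_succ, Fin.succAbove]
      ring
    rw [hd, Complex.ofReal_ne_zero]
    exact mul_ne_zero (neg_ne_zero.mpr (S.jac_fixed₁ i)) (S.jac_fixed₂ i)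

/-- The solutions of the polynomial system, parametrised by the orbits of listed secants together
with choices of signs. -/
def sol : (Fin 4 × Bool × Bool × Bool) ⊕ (Fin 2 × Bool × Bool) → Fin 4 → ℂ
  | .inl (i, ε₁, ε₂, ε₃) =>
    pointOf (sgn ε₁ * csqrt (S.w i)) (sgn ε₂ * csqrt (S.w i - 4 * (S.ρ * S.y i) : ℝ))
      (S.r i * (sgn ε₁ * csqrt (S.w i))) (sgn ε₃ * csqrt (S.r i ^ 2 * S.w i - 4 * S.y i : ℝ))
  | .inr (i, ε₂, ε₃) =>
    pointOf 0 (sgn ε₂ * csqrt (-4 * S.n i : ℝ)) 0 (sgn ε₃ * csqrt (-4 * S.z i : ℝ))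

lemma neg_four_mul_ne {x : ℝ} (hx : x ≠ 0) : ((-4 * x : ℝ) : ℂ) ≠ 0 := by
  simpa using hx

lemma sol_injective : Function.Injective S.sol := by
  have hw (i) : (S.w i : ℂ) ≠ 0 := mod_cast S.w_ne i
  have hne (i : Fin 4) (ε : Bool) : sgn ε * csqrt (S.w i) ≠ 0 := sgn_mul_csqrt_ne_zero ε (hw i)
  rintro (⟨i, ε₁, ε₂, ε₃⟩ | ⟨i, ε₂, ε₃⟩) (⟨j, φ₁, φ₂, φ₃⟩ | ⟨j, φ₂, φ₃⟩) hij
  · obtain ⟨h₁, h₂, h₃, h₄⟩ := pointOf_inj hij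
    have hy : (S.y i : ℂ) = S.y j := by
      have e₁ := sgn_mul_csqrt_sq ε₁ (S.w i)
      have e₂ := sgn_mul_csqrt_sq φ₁ (S.w j)
      have e₃ := sgn_mul_csqrt_sq ε₃ (S.r i ^ 2 * S.w i - 4 * S.y i : ℝ)
      have e₄ := sgn_mul_csqrt_sq φ₃ (S.r j ^ 2 * S.w j - 4 * S.y j : ℝ)
      have e₅ := congrArg (· ^ 2) h₃
      simp only [mul_pow (S.r _ : ℂ), e₁, e₂] at e₅
      rw [h₄, e₄] at e₃
      push_cast at e₃
      linear_combination (e₅ + e₃) / 4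
    obtain rfl := S.y_inj (by exact_mod_cast hy)
    obtain rfl := sgn_mul_csqrt_inj (hw i) h₁
    obtain rfl := sgn_mul_csqrt_inj (by exact_mod_cast S.disc_t i) h₂
    obtain rfl := sgn_mul_csqrt_inj (by exact_mod_cast S.disc_s i) h₄
    rfl
  · exact absurd (pointOf_inj hij).1 (hne i ε₁)
  · exact absurd (pointOf_inj hij).1.symm (hne j φ₁)
  · obtain ⟨-, h₂, -, h₄⟩ := pointOf_inj hij
    have hz : (S.z i : ℂ) = S.z j := by
      have e₃ := sgn_mul_csqrt_sq ε₃ (-4 * S.z i : ℝ)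
      have e₄ := sgn_mul_csqrt_sq φ₃ (-4 * S.z j : ℝ)
      rw [h₄, e₄] at e₃
      push_cast at e₃
      linear_combination e₃ / 4
    obtain rfl := S.z_inj (by exact_mod_cast hz)
    obtain rfl := sgn_mul_csqrt_inj (neg_four_mul_ne (S.n_ne i)) h₂
    obtain rfl := sgn_mul_csqrt_inj (neg_four_mul_ne (S.z_ne i)) h₄
    rfl

lemma mem_Ssol_iff {x : Fin 4 → ℂ} : x ∈ Ssol (cm S.mat) ↔
    S.IsListed (x 0 + x 1) (x 0 * x 1) (x 2 + x 3) (x 2 * x 3) ∧ x 0 ≠ x 1 ∧ x 2 ≠ x 3 := by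
  rw [mat, mem_Ssol_evenMat, isCommonSecant_iff]

lemma sol_mem (k) : S.sol k ∈ Ssol (cm S.mat) := by
  rw [mem_Ssol_iff]
  obtain ⟨i, ε₁, ε₂, ε₃⟩ | ⟨i, ε₂, ε₃⟩ := k
  · obtain ⟨h₁, h₂, h₃, h₄⟩ := pointOf_eq_iff.mp (rfl : S.sol (.inl (i, ε₁, ε₂, ε₃)) = _)
    set x := S.sol (.inl (i, ε₁, ε₂, ε₃))
    have e₁ := sgn_mul_csqrt_sq ε₁ (S.w i)
    have e₂ := sgn_mul_csqrt_sq ε₂ (S.w i - 4 * (S.ρ * S.y i) : ℝ)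
    have e₃ := sgn_mul_csqrt_sq ε₃ (S.r i ^ 2 * S.w i - 4 * S.y i : ℝ)
    rw [h₁] at e₁ h₃
    rw [h₂] at e₂
    rw [h₄] at e₃
    refine ⟨Or.inl ⟨i, e₁, ?_, h₃.symm, ?_⟩, ?_, ?_⟩
    · push_cast at e₂
      linear_combination (e₁ - e₂) / 4
    · push_cast at e₃
      linear_combination (S.r i ^ 2 * e₁ - e₃) / 4 - (x 2 + x 3 + S.r i * (x 0 + x 1)) / 4 * h₃
    · rw [← sub_ne_zero, ← h₂]
      exact sgn_mul_csqrt_ne_zero _ (by exact_mod_cast S.disc_t i)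
    · rw [← sub_ne_zero, ← h₄]
      exact sgn_mul_csqrt_ne_zero _ (by exact_mod_cast S.disc_s i)
  · obtain ⟨h₁, h₂, h₃, h₄⟩ := pointOf_eq_iff.mp (rfl : S.sol (.inr (i, ε₂, ε₃)) = _)
    set x := S.sol (.inr (i, ε₂, ε₃))
    have e₂ := sgn_mul_csqrt_sq ε₂ (-4 * S.n i : ℝ)
    have e₃ := sgn_mul_csqrt_sq ε₃ (-4 * S.z i : ℝ)
    rw [h₂] at e₂
    rw [h₄] at e₃
    refine ⟨Or.inr ⟨i, h₁.symm, ?_, h₃.symm, ?_⟩, ?_, ?_⟩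
    · push_cast at e₂
      linear_combination -e₂ / 4 - (x 0 + x 1) / 4 * h₁
    · push_cast at e₃
      linear_combination -e₃ / 4 - (x 2 + x 3) / 4 * h₃
    · rw [← sub_ne_zero, ← h₂]
      exact sgn_mul_csqrt_ne_zero _ (neg_four_mul_ne (S.n_ne i))
    · rw [← sub_ne_zero, ← h₄]
      exact sgn_mul_csqrt_ne_zero _ (neg_four_mul_ne (S.z_ne i))

lemma range_sol : Set.range S.sol = Ssol (cm S.mat) := by
  refine Set.Subset.antisymm (Set.range_subset_iff.mpr S.sol_mem) fun x hx => ?_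
  obtain ⟨⟨i, hp, hq, hu, hv⟩ | ⟨i, hp, hq, hu, hv⟩, -, -⟩ := S.mem_Ssol_iff.mp hx
  · obtain ⟨ε₁, h₁⟩ := exists_eq_sgn_mul_csqrt hp
    obtain ⟨ε₂, h₂⟩ := exists_eq_sgn_mul_csqrt (t := x 0 - x 1)
      (x := (S.w i - 4 * (S.ρ * S.y i) : ℝ)) (by push_cast; linear_combination hp - 4 * hq)
    obtain ⟨ε₃, h₃⟩ := exists_eq_sgn_mul_csqrt (t := x 2 - x 3)
      (x := (S.r i ^ 2 * S.w i - 4 * S.y i : ℝ)) (by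
        push_cast
        linear_combination (x 2 + x 3 + S.r i * (x 0 + x 1)) * hu + S.r i ^ 2 * hp - 4 * hv)
    exact ⟨.inl (i, ε₁, ε₂, ε₃), pointOf_eq_iff.mpr ⟨h₁, h₂, by rw [h₁, hu], h₃⟩⟩
  · obtain ⟨ε₂, h₂⟩ := exists_eq_sgn_mul_csqrt (t := x 0 - x 1) (x := (-4 * S.n i : ℝ))
      (by push_cast; linear_combination (x 0 + x 1) * hp - 4 * hq)
    obtain ⟨ε₃, h₃⟩ := exists_eq_sgn_mul_csqrt (t := x 2 - x 3) (x := (-4 * S.z i : ℝ))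
      (by push_cast; linear_combination (x 2 + x 3) * hu - 4 * hv)
    exact ⟨.inr (i, ε₂, ε₃), pointOf_eq_iff.mpr ⟨hp.symm, h₂, hu.symm, h₃⟩⟩

/-- The indices of the solutions whose orbit lies in `I` or `J`. -/
def indices (I : Finset (Fin 4)) (J : Finset (Fin 2)) :
    Finset ((Fin 4 × Bool × Bool × Bool) ⊕ (Fin 2 × Bool × Bool)) :=
  (I ×ˢ Finset.univ).disjSum (J ×ˢ Finset.univ)

lemma card_indices (I : Finset (Fin 4)) (J : Finset (Fin 2)) :
    (indices I J).card = 8 * I.card + 4 * J.card := by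
  simp [indices]
  ring

lemma ncard_sol_image (I : Finset (Fin 4)) (J : Finset (Fin 2)) :
    (S.sol '' (indices I J : Set _)).ncard = 8 * I.card + 4 * J.card := by
  rw [Set.ncard_image_of_injective _ S.sol_injective, Set.ncard_coe_finset, card_indices]

theorem exists_matrix (I : Finset (Fin 4)) (J : Finset (Fin 2))
    (hI : ∀ i, i ∈ I ↔ 0 < S.w i ∧ 0 < S.w i - 4 * (S.ρ * S.y i) ∧
      0 < S.r i ^ 2 * S.w i - 4 * S.y i)
    (hJ : ∀ i, i ∈ J ↔ S.n i < 0 ∧ S.z i < 0) {k : ℕ} (hk : 2 * I.card + J.card = k) :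
    ∃ M : Matrix (Fin 4) (Fin 4) ℝ, IsUnit M.det ∧
      (Ssol (cm M)).ncard = 40 ∧
      (∀ x ∈ Ssol (cm M), IsUnit (Jac (cm M) x)) ∧
      {x ∈ Ssol (cm M) | ∀ i, (x i).im = 0}.ncard = 4 * k := by
  refine ⟨S.mat, S.isUnit_det_mat, ?_, fun x hx => ?_, ?_⟩
  · have hall : ((indices Finset.univ Finset.univ : Finset _) : Set ((Fin 4 × Bool × Bool × Bool) ⊕ (Fin 2 × Bool × Bool))) = Set.univ := by
      ext k
      simp [indices]
    rw [← range_sol, ← Set.image_univ, ← hall, ncard_sol_image]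
    simp
  · obtain ⟨hl, ht, hs⟩ := S.mem_Ssol_iff.mp hx
    exact isUnit_Jac_evenMat hl.isCommonSecant ht hs (S.secantJac_det_ne_zero hl)
  · have hreal : {x ∈ Ssol (cm S.mat) | ∀ i, (x i).im = 0} = S.sol '' (indices I J : Set _) := by
      have key (k) : (∀ l, (S.sol k l).im = 0) ↔ k ∈ indices I J := by
        obtain ⟨i, ε₁, ε₂, ε₃⟩ | ⟨i, ε₂, ε₃⟩ := k
        · rw [sol, im_pointOf, im_eq_zero_iff_of_sq_eq (S.w_ne i) (sgn_mul_csqrt_sq _ _),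
            im_eq_zero_iff_of_sq_eq (S.disc_t i) (sgn_mul_csqrt_sq _ _),
            im_eq_zero_iff_of_sq_eq (S.disc_s i) (sgn_mul_csqrt_sq _ _), Complex.im_ofReal_mul,
            mul_eq_zero, or_iff_right (S.r_ne i),
            im_eq_zero_iff_of_sq_eq (S.w_ne i) (sgn_mul_csqrt_sq _ _)]
          simp [indices, hI]
          tauto
        · rw [sol, im_pointOf,
            im_eq_zero_iff_of_sq_eq (by simpa using S.n_ne i) (sgn_mul_csqrt_sq _ _),
            im_eq_zero_iff_of_sq_eq (by simpa using S.z_ne i) (sgn_mul_csqrt_sq _ _)]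
          have h4 (t : ℝ) : 0 < -4 * t ↔ t < 0 := by constructor <;> intro <;> linarith
          rw [h4, h4]
          simp [indices, hJ]
      ext x
      rw [← range_sol]
      constructor
      · rintro ⟨⟨k, rfl⟩, hx⟩
        exact ⟨k, (key k).mp hx, rfl⟩
      · rintro ⟨k, hx, rfl⟩
        exact ⟨⟨k, rfl⟩, (key k).mpr hx⟩
    rw [hreal, ncard_sol_image, ← hk]
    ring

end SymmetricSecants

/-- A matrix with exactly zero totally real common secants. -/
def secantsZero : SymmetricSecants where
  a := 0
  b := 1
  c := 5
  e := 6
  f := 0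
  g := -19
  h := -5
  ρ := 1
  y := ![-1, 2, 3, 6]
  r := ![-1, 1, 1, -1]
  w := ![-5, -1, 1, -5]
  z := ![2, 3]
  n := ![3, 2]
  e_ne := by norm_num
  ρ_ne := by norm_num
  minor_ne := by norm_num
  minor_ne' := by norm_num
  minor_eq := by norm_num
  vieta₁ := by simp only [Matrix.cons_val]; norm_num
  vieta₂ := by simp only [Matrix.cons_val]; norm_num
  vieta₃ := by simp only [Matrix.cons_val]; norm_num
  vieta₄ := by simp only [Matrix.cons_val]; norm_num
  lead_ne := by norm_num
  vieta_sum := by simp only [Matrix.cons_val]; norm_num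
  vieta_prod := by simp only [Matrix.cons_val]; norm_num
  y_inj := by
    intro i j
    fin_cases i <;> fin_cases j <;> norm_num
  z_inj := by
    intro i j
    fin_cases i <;> fin_cases j <;> norm_num
  y_ne i := by fin_cases i <;> norm_num
  r_ne i := by fin_cases i <;> norm_num
  w_ne i := by fin_cases i <;> norm_num
  z_ne i := by fin_cases i <;> norm_num
  n_ne i := by fin_cases i <;> norm_num
  h_add_ne i := by fin_cases i <;> norm_num
  disc_t i := by fin_cases i <;> norm_num
  disc_s i := by fin_cases i <;> norm_num
  pair₁ i := by fin_cases i <;> norm_num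
  pair₂ i := by fin_cases i <;> norm_num
  pair₃ i := by fin_cases i <;> norm_num
  pair₄ i := by fin_cases i <;> norm_num
  fixed₁ i := by fin_cases i <;> norm_num
  fixed₂ i := by fin_cases i <;> norm_num
  jac_pair i := by
    rw [pairJac, det_fin_four_of]
    fin_cases i <;> norm_num
  jac_fixed₁ i := by fin_cases i <;> norm_num
  jac_fixed₂ i := by fin_cases i <;> norm_num

/-- A matrix with exactly one totally real common secant. -/
def secantsOne : SymmetricSecants where
  a := 4
  b := 0
  c := 2
  e := 8
  f := 11
  g := 70
  h := 13
  ρ := -1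
  y := ![1, 2, 4, 8]
  r := ![1/4, 7/11, 1, 2]
  w := ![28, 121/7, 13, 7]
  z := ![-6, 4]
  n := ![-37/2, 9]
  e_ne := by norm_num
  ρ_ne := by norm_num
  minor_ne := by norm_num
  minor_ne' := by norm_num
  minor_eq := by norm_num
  vieta₁ := by simp only [Matrix.cons_val]; norm_num
  vieta₂ := by simp only [Matrix.cons_val]; norm_num
  vieta₃ := by simp only [Matrix.cons_val]; norm_num
  vieta₄ := by simp only [Matrix.cons_val]; norm_num
  lead_ne := by norm_num
  vieta_sum := by simp only [Matrix.cons_val]; norm_num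
  vieta_prod := by simp only [Matrix.cons_val]; norm_num
  y_inj := by
    intro i j
    fin_cases i <;> fin_cases j <;> norm_num
  z_inj := by
    intro i j
    fin_cases i <;> fin_cases j <;> norm_num
  y_ne i := by fin_cases i <;> norm_num
  r_ne i := by fin_cases i <;> norm_num
  w_ne i := by fin_cases i <;> norm_num
  z_ne i := by fin_cases i <;> norm_num
  n_ne i := by fin_cases i <;> norm_num
  h_add_ne i := by fin_cases i <;> norm_num
  disc_t i := by fin_cases i <;> norm_num
  disc_s i := by fin_cases i <;> norm_num
  pair₁ i := by fin_cases i <;> norm_num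
  pair₂ i := by fin_cases i <;> norm_num
  pair₃ i := by fin_cases i <;> norm_num
  pair₄ i := by fin_cases i <;> norm_num
  fixed₁ i := by fin_cases i <;> norm_num
  fixed₂ i := by fin_cases i <;> norm_num
  jac_pair i := by
    rw [pairJac, det_fin_four_of]
    fin_cases i <;> norm_num
  jac_fixed₁ i := by fin_cases i <;> norm_num
  jac_fixed₂ i := by fin_cases i <;> norm_num

/-- A matrix with exactly two totally real common secants. -/
def secantsTwo : SymmetricSecants where
  a := 0
  b := 1
  c := 5
  e := 6
  f := 10
  g := 31
  h := 5
  ρ := 1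
  y := ![-6, 1, 2, 3]
  r := ![-11, 2/3, 1, 1]
  w := ![-5/11, 15/2, 9, 11]
  z := ![2, 3]
  n := ![-7, -8]
  e_ne := by norm_num
  ρ_ne := by norm_num
  minor_ne := by norm_num
  minor_ne' := by norm_num
  minor_eq := by norm_num
  vieta₁ := by simp only [Matrix.cons_val]; norm_num
  vieta₂ := by simp only [Matrix.cons_val]; norm_num
  vieta₃ := by simp only [Matrix.cons_val]; norm_num
  vieta₄ := by simp only [Matrix.cons_val]; norm_num
  lead_ne := by norm_num
  vieta_sum := by simp only [Matrix.cons_val]; norm_num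
  vieta_prod := by simp only [Matrix.cons_val]; norm_num
  y_inj := by
    intro i j
    fin_cases i <;> fin_cases j <;> norm_num
  z_inj := by
    intro i j
    fin_cases i <;> fin_cases j <;> norm_num
  y_ne i := by fin_cases i <;> norm_num
  r_ne i := by fin_cases i <;> norm_num
  w_ne i := by fin_cases i <;> norm_num
  z_ne i := by fin_cases i <;> norm_num
  n_ne i := by fin_cases i <;> norm_num
  h_add_ne i := by fin_cases i <;> norm_num
  disc_t i := by fin_cases i <;> norm_num
  disc_s i := by fin_cases i <;> norm_num
  pair₁ i := by fin_cases i <;> norm_num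
  pair₂ i := by fin_cases i <;> norm_num
  pair₃ i := by fin_cases i <;> norm_num
  pair₄ i := by fin_cases i <;> norm_num
  fixed₁ i := by fin_cases i <;> norm_num
  fixed₂ i := by fin_cases i <;> norm_num
  jac_pair i := by
    rw [pairJac, det_fin_four_of]
    fin_cases i <;> norm_num
  jac_fixed₁ i := by fin_cases i <;> norm_num
  jac_fixed₂ i := by fin_cases i <;> norm_num

/-- A matrix with exactly three totally real common secants. -/
def secantsThree : SymmetricSecants where
  a := 1
  b := 5
  c := 8
  e := 8
  f := 14
  g := 30
  h := 7
  ρ := -1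
  y := ![1, 2, 4, 8]
  r := ![1, 2, 4, -13]
  w := ![2, 1/2, -7/4, 2]
  z := ![17/7, -2/3]
  n := ![-7/3, -4]
  e_ne := by norm_num
  ρ_ne := by norm_num
  minor_ne := by norm_num
  minor_ne' := by norm_num
  minor_eq := by norm_num
  vieta₁ := by simp only [Matrix.cons_val]; norm_num
  vieta₂ := by simp only [Matrix.cons_val]; norm_num
  vieta₃ := by simp only [Matrix.cons_val]; norm_num
  vieta₄ := by simp only [Matrix.cons_val]; norm_num
  lead_ne := by norm_num
  vieta_sum := by simp only [Matrix.cons_val]; norm_num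
  vieta_prod := by simp only [Matrix.cons_val]; norm_num
  y_inj := by
    intro i j
    fin_cases i <;> fin_cases j <;> norm_num
  z_inj := by
    intro i j
    fin_cases i <;> fin_cases j <;> norm_num
  y_ne i := by fin_cases i <;> norm_num
  r_ne i := by fin_cases i <;> norm_num
  w_ne i := by fin_cases i <;> norm_num
  z_ne i := by fin_cases i <;> norm_num
  n_ne i := by fin_cases i <;> norm_num
  h_add_ne i := by fin_cases i <;> norm_num
  disc_t i := by fin_cases i <;> norm_num
  disc_s i := by fin_cases i <;> norm_num
  pair₁ i := by fin_cases i <;> norm_num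
  pair₂ i := by fin_cases i <;> norm_num
  pair₃ i := by fin_cases i <;> norm_num
  pair₄ i := by fin_cases i <;> norm_num
  fixed₁ i := by fin_cases i <;> norm_num
  fixed₂ i := by fin_cases i <;> norm_num
  jac_pair i := by
    rw [pairJac, det_fin_four_of]
    fin_cases i <;> norm_num
  jac_fixed₁ i := by fin_cases i <;> norm_num
  jac_fixed₂ i := by fin_cases i <;> norm_num

/-- A matrix with exactly four totally real common secants. -/
def secantsFour : SymmetricSecants where
  a := 0
  b := 1
  c := 7
  e := 12
  f := 18
  g := 89
  h := 11
  ρ := 1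
  y := ![-12, 1, 3, 4]
  r := ![-19, 1/2, 1, 1]
  w := ![-7/19, 14, 17, 19]
  z := ![3, 4]
  n := ![-14, -15]
  e_ne := by norm_num
  ρ_ne := by norm_num
  minor_ne := by norm_num
  minor_ne' := by norm_num
  minor_eq := by norm_num
  vieta₁ := by simp only [Matrix.cons_val]; norm_num
  vieta₂ := by simp only [Matrix.cons_val]; norm_num
  vieta₃ := by simp only [Matrix.cons_val]; norm_num
  vieta₄ := by simp only [Matrix.cons_val]; norm_num
  lead_ne := by norm_num
  vieta_sum := by simp only [Matrix.cons_val]; norm_num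
  vieta_prod := by simp only [Matrix.cons_val]; norm_num
  y_inj := by
    intro i j
    fin_cases i <;> fin_cases j <;> norm_num
  z_inj := by
    intro i j
    fin_cases i <;> fin_cases j <;> norm_num
  y_ne i := by fin_cases i <;> norm_num
  r_ne i := by fin_cases i <;> norm_num
  w_ne i := by fin_cases i <;> norm_num
  z_ne i := by fin_cases i <;> norm_num
  n_ne i := by fin_cases i <;> norm_num
  h_add_ne i := by fin_cases i <;> norm_num
  disc_t i := by fin_cases i <;> norm_num
  disc_s i := by fin_cases i <;> norm_num
  pair₁ i := by fin_cases i <;> norm_num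
  pair₂ i := by fin_cases i <;> norm_num
  pair₃ i := by fin_cases i <;> norm_num
  pair₄ i := by fin_cases i <;> norm_num
  fixed₁ i := by fin_cases i <;> norm_num
  fixed₂ i := by fin_cases i <;> norm_num
  jac_pair i := by
    rw [pairJac, det_fin_four_of]
    fin_cases i <;> norm_num
  jac_fixed₁ i := by fin_cases i <;> norm_num
  jac_fixed₂ i := by fin_cases i <;> norm_num

/-- A matrix with exactly five totally real common secants. -/
def secantsFive : SymmetricSecants where
  a := 8
  b := -1
  c := -5
  e := 12
  f := -6
  g := 1
  h := 7
  ρ := 1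
  y := ![-12, -3, -1, 4]
  r := ![1, -1/2, 1, -9/11]
  w := ![-1, 14, -1, 77/3]
  z := ![-17, 4]
  n := ![-10, -3]
  e_ne := by norm_num
  ρ_ne := by norm_num
  minor_ne := by norm_num
  minor_ne' := by norm_num
  minor_eq := by norm_num
  vieta₁ := by simp only [Matrix.cons_val]; norm_num
  vieta₂ := by simp only [Matrix.cons_val]; norm_num
  vieta₃ := by simp only [Matrix.cons_val]; norm_num
  vieta₄ := by simp only [Matrix.cons_val]; norm_num
  lead_ne := by norm_num
  vieta_sum := by simp only [Matrix.cons_val]; norm_num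
  vieta_prod := by simp only [Matrix.cons_val]; norm_num
  y_inj := by
    intro i j
    fin_cases i <;> fin_cases j <;> norm_num
  z_inj := by
    intro i j
    fin_cases i <;> fin_cases j <;> norm_num
  y_ne i := by fin_cases i <;> norm_num
  r_ne i := by fin_cases i <;> norm_num
  w_ne i := by fin_cases i <;> norm_num
  z_ne i := by fin_cases i <;> norm_num
  n_ne i := by fin_cases i <;> norm_num
  h_add_ne i := by fin_cases i <;> norm_num
  disc_t i := by fin_cases i <;> norm_num
  disc_s i := by fin_cases i <;> norm_num
  pair₁ i := by fin_cases i <;> norm_num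
  pair₂ i := by fin_cases i <;> norm_num
  pair₃ i := by fin_cases i <;> norm_num
  pair₄ i := by fin_cases i <;> norm_num
  fixed₁ i := by fin_cases i <;> norm_num
  fixed₂ i := by fin_cases i <;> norm_num
  jac_pair i := by
    rw [pairJac, det_fin_four_of]
    fin_cases i <;> norm_num
  jac_fixed₁ i := by fin_cases i <;> norm_num
  jac_fixed₂ i := by fin_cases i <;> norm_num

/-- A matrix with exactly six totally real common secants. -/
def secantsSix : SymmetricSecants where
  a := 0
  b := -1
  c := -5
  e := 6
  f := 0
  g := -31
  h := 5
  ρ := 1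
  y := ![-6, -3, -2, 1]
  r := ![-1, 1, 1, -1]
  w := ![-7, 5, 5, 7]
  z := ![-6, 1]
  n := ![1, -6]
  e_ne := by norm_num
  ρ_ne := by norm_num
  minor_ne := by norm_num
  minor_ne' := by norm_num
  minor_eq := by norm_num
  vieta₁ := by simp only [Matrix.cons_val]; norm_num
  vieta₂ := by simp only [Matrix.cons_val]; norm_num
  vieta₃ := by simp only [Matrix.cons_val]; norm_num
  vieta₄ := by simp only [Matrix.cons_val]; norm_num
  lead_ne := by norm_num
  vieta_sum := by simp only [Matrix.cons_val]; norm_num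
  vieta_prod := by simp only [Matrix.cons_val]; norm_num
  y_inj := by
    intro i j
    fin_cases i <;> fin_cases j <;> norm_num
  z_inj := by
    intro i j
    fin_cases i <;> fin_cases j <;> norm_num
  y_ne i := by fin_cases i <;> norm_num
  r_ne i := by fin_cases i <;> norm_num
  w_ne i := by fin_cases i <;> norm_num
  z_ne i := by fin_cases i <;> norm_num
  n_ne i := by fin_cases i <;> norm_num
  h_add_ne i := by fin_cases i <;> norm_num
  disc_t i := by fin_cases i <;> norm_num
  disc_s i := by fin_cases i <;> norm_num
  pair₁ i := by fin_cases i <;> norm_num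
  pair₂ i := by fin_cases i <;> norm_num
  pair₃ i := by fin_cases i <;> norm_num
  pair₄ i := by fin_cases i <;> norm_num
  fixed₁ i := by fin_cases i <;> norm_num
  fixed₂ i := by fin_cases i <;> norm_num
  jac_pair i := by
    rw [pairJac, det_fin_four_of]
    fin_cases i <;> norm_num
  jac_fixed₁ i := by fin_cases i <;> norm_num
  jac_fixed₂ i := by fin_cases i <;> norm_num

/-- A matrix with exactly seven totally real common secants. -/
def secantsSeven : SymmetricSecants where
  a := 8
  b := 0
  c := -8
  e := 4
  f := 3
  g := 0
  h := -3
  ρ := 1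
  y := ![-4, -2, -1, 2]
  r := ![-4/7, -1, -7/4, -1]
  w := ![7, 3, 4/7, 7]
  z := ![-8/3, 4]
  n := ![-3/2, 1]
  e_ne := by norm_num
  ρ_ne := by norm_num
  minor_ne := by norm_num
  minor_ne' := by norm_num
  minor_eq := by norm_num
  vieta₁ := by simp only [Matrix.cons_val]; norm_num
  vieta₂ := by simp only [Matrix.cons_val]; norm_num
  vieta₃ := by simp only [Matrix.cons_val]; norm_num
  vieta₄ := by simp only [Matrix.cons_val]; norm_num
  lead_ne := by norm_num
  vieta_sum := by simp only [Matrix.cons_val]; norm_num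
  vieta_prod := by simp only [Matrix.cons_val]; norm_num
  y_inj := by
    intro i j
    fin_cases i <;> fin_cases j <;> norm_num
  z_inj := by
    intro i j
    fin_cases i <;> fin_cases j <;> norm_num
  y_ne i := by fin_cases i <;> norm_num
  r_ne i := by fin_cases i <;> norm_num
  w_ne i := by fin_cases i <;> norm_num
  z_ne i := by fin_cases i <;> norm_num
  n_ne i := by fin_cases i <;> norm_num
  h_add_ne i := by fin_cases i <;> norm_num
  disc_t i := by fin_cases i <;> norm_num
  disc_s i := by fin_cases i <;> norm_num
  pair₁ i := by fin_cases i <;> norm_num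
  pair₂ i := by fin_cases i <;> norm_num
  pair₃ i := by fin_cases i <;> norm_num
  pair₄ i := by fin_cases i <;> norm_num
  fixed₁ i := by fin_cases i <;> norm_num
  fixed₂ i := by fin_cases i <;> norm_num
  jac_pair i := by
    rw [pairJac, det_fin_four_of]
    fin_cases i <;> norm_num
  jac_fixed₁ i := by fin_cases i <;> norm_num
  jac_fixed₂ i := by fin_cases i <;> norm_num

/-- A matrix with exactly eight totally real common secants. -/
def secantsEight : SymmetricSecants where
  a := 0
  b := 1
  c := -5
  e := 6
  f := 0
  g := -19
  h := 5
  ρ := 1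
  y := ![-6, -3, -2, 1]
  r := ![-1, 1, 1, -1]
  w := ![5, -1, 1, 5]
  z := ![-2, -3]
  n := ![-3, -2]
  e_ne := by norm_num
  ρ_ne := by norm_num
  minor_ne := by norm_num
  minor_ne' := by norm_num
  minor_eq := by norm_num
  vieta₁ := by simp only [Matrix.cons_val]; norm_num
  vieta₂ := by simp only [Matrix.cons_val]; norm_num
  vieta₃ := by simp only [Matrix.cons_val]; norm_num
  vieta₄ := by simp only [Matrix.cons_val]; norm_num
  lead_ne := by norm_num
  vieta_sum := by simp only [Matrix.cons_val]; norm_num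
  vieta_prod := by simp only [Matrix.cons_val]; norm_num
  y_inj := by
    intro i j
    fin_cases i <;> fin_cases j <;> norm_num
  z_inj := by
    intro i j
    fin_cases i <;> fin_cases j <;> norm_num
  y_ne i := by fin_cases i <;> norm_num
  r_ne i := by fin_cases i <;> norm_num
  w_ne i := by fin_cases i <;> norm_num
  z_ne i := by fin_cases i <;> norm_num
  n_ne i := by fin_cases i <;> norm_num
  h_add_ne i := by fin_cases i <;> norm_num
  disc_t i := by fin_cases i <;> norm_num
  disc_s i := by fin_cases i <;> norm_num
  pair₁ i := by fin_cases i <;> norm_num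
  pair₂ i := by fin_cases i <;> norm_num
  pair₃ i := by fin_cases i <;> norm_num
  pair₄ i := by fin_cases i <;> norm_num
  fixed₁ i := by fin_cases i <;> norm_num
  fixed₂ i := by fin_cases i <;> norm_num
  jac_pair i := by
    rw [pairJac, det_fin_four_of]
    fin_cases i <;> norm_num
  jac_fixed₁ i := by fin_cases i <;> norm_num
  jac_fixed₂ i := by fin_cases i <;> norm_num

/-- A matrix with exactly nine totally real common secants. -/
def secantsNine : SymmetricSecants where
  a := 0
  b := -1
  c := 1
  e := 6
  f := -8
  g := 1
  h := 7
  ρ := 1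
  y := ![-6, -2, -1, 3]
  r := ![-7, -1, -1/3, -1]
  w := ![1/7, 3, 3, 13]
  z := ![3, -2]
  n := ![-10, -5]
  e_ne := by norm_num
  ρ_ne := by norm_num
  minor_ne := by norm_num
  minor_ne' := by norm_num
  minor_eq := by norm_num
  vieta₁ := by simp only [Matrix.cons_val]; norm_num
  vieta₂ := by simp only [Matrix.cons_val]; norm_num
  vieta₃ := by simp only [Matrix.cons_val]; norm_num
  vieta₄ := by simp only [Matrix.cons_val]; norm_num
  lead_ne := by norm_num
  vieta_sum := by simp only [Matrix.cons_val]; norm_num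
  vieta_prod := by simp only [Matrix.cons_val]; norm_num
  y_inj := by
    intro i j
    fin_cases i <;> fin_cases j <;> norm_num
  z_inj := by
    intro i j
    fin_cases i <;> fin_cases j <;> norm_num
  y_ne i := by fin_cases i <;> norm_num
  r_ne i := by fin_cases i <;> norm_num
  w_ne i := by fin_cases i <;> norm_num
  z_ne i := by fin_cases i <;> norm_num
  n_ne i := by fin_cases i <;> norm_num
  h_add_ne i := by fin_cases i <;> norm_num
  disc_t i := by fin_cases i <;> norm_num
  disc_s i := by fin_cases i <;> norm_num
  pair₁ i := by fin_cases i <;> norm_num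
  pair₂ i := by fin_cases i <;> norm_num
  pair₃ i := by fin_cases i <;> norm_num
  pair₄ i := by fin_cases i <;> norm_num
  fixed₁ i := by fin_cases i <;> norm_num
  fixed₂ i := by fin_cases i <;> norm_num
  jac_pair i := by
    rw [pairJac, det_fin_four_of]
    fin_cases i <;> norm_num
  jac_fixed₁ i := by fin_cases i <;> norm_num
  jac_fixed₂ i := by fin_cases i <;> norm_num

/-- A matrix with exactly ten totally real common secants. -/
def secantsTen : SymmetricSecants where
  a := 2
  b := -1
  c := -5
  e := 10
  f := -6
  g := -43
  h := 9
  ρ := 1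
  y := ![-10, -5, -1, 2]
  r := ![5, -1, 1/2, -1]
  w := ![3/5, 1, 6, 15]
  z := ![-4, -3]
  n := ![-7, -8]
  e_ne := by norm_num
  ρ_ne := by norm_num
  minor_ne := by norm_num
  minor_ne' := by norm_num
  minor_eq := by norm_num
  vieta₁ := by simp only [Matrix.cons_val]; norm_num
  vieta₂ := by simp only [Matrix.cons_val]; norm_num
  vieta₃ := by simp only [Matrix.cons_val]; norm_num
  vieta₄ := by simp only [Matrix.cons_val]; norm_num
  lead_ne := by norm_num
  vieta_sum := by simp only [Matrix.cons_val]; norm_num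
  vieta_prod := by simp only [Matrix.cons_val]; norm_num
  y_inj := by
    intro i j
    fin_cases i <;> fin_cases j <;> norm_num
  z_inj := by
    intro i j
    fin_cases i <;> fin_cases j <;> norm_num
  y_ne i := by fin_cases i <;> norm_num
  r_ne i := by fin_cases i <;> norm_num
  w_ne i := by fin_cases i <;> norm_num
  z_ne i := by fin_cases i <;> norm_num
  n_ne i := by fin_cases i <;> norm_num
  h_add_ne i := by fin_cases i <;> norm_num
  disc_t i := by fin_cases i <;> norm_num
  disc_s i := by fin_cases i <;> norm_num
  pair₁ i := by fin_cases i <;> norm_num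
  pair₂ i := by fin_cases i <;> norm_num
  pair₃ i := by fin_cases i <;> norm_num
  pair₄ i := by fin_cases i <;> norm_num
  fixed₁ i := by fin_cases i <;> norm_num
  fixed₂ i := by fin_cases i <;> norm_num
  jac_pair i := by
    rw [pairJac, det_fin_four_of]
    fin_cases i <;> norm_num
  jac_fixed₁ i := by fin_cases i <;> norm_num
  jac_fixed₂ i := by fin_cases i <;> norm_num

/-- For each `k ∈ {0, 1, …, 10}` there is an invertible real matrix `M` such that `S(M)`
has exactly 40 elements, all nonsingular, of which exactly `4k` lie in `ℝ⁴`; i.e., the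
standard twisted cubic and its image under `M` have ten common secant lines, exactly `k`
of which are totally real. -/
theorem exists_k_totally_real (k : ℕ) (hk : k ≤ 10) :
    ∃ M : Matrix (Fin 4) (Fin 4) ℝ, IsUnit M.det ∧
      (Ssol (cm M)).ncard = 40 ∧
      (∀ x ∈ Ssol (cm M), IsUnit (Jac (cm M) x)) ∧
      {x ∈ Ssol (cm M) | ∀ i, (x i).im = 0}.ncard = 4 * k := by
  interval_cases k
  · refine secantsZero.exists_matrix ∅ ∅ (fun i => ?_) (fun i => ?_) rfl <;>
      fin_cases i <;> norm_num [secantsZero]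
  · refine secantsOne.exists_matrix ∅ {0} (fun i => ?_) (fun i => ?_) rfl <;>
      fin_cases i <;> norm_num [secantsOne]
  · refine secantsTwo.exists_matrix {2} ∅ (fun i => ?_) (fun i => ?_) rfl <;>
      fin_cases i <;> norm_num [secantsTwo] <;> decide
  · refine secantsThree.exists_matrix {3} {1} (fun i => ?_) (fun i => ?_) rfl <;>
      fin_cases i <;> norm_num [secantsThree] <;> decide
  · refine secantsFour.exists_matrix {2, 3} ∅ (fun i => ?_) (fun i => ?_) rfl <;>
      fin_cases i <;> norm_num [secantsFour] <;> decide
  · refine secantsFive.exists_matrix {1, 3} {0} (fun i => ?_) (fun i => ?_) rfl <;>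
      fin_cases i <;> norm_num [secantsFive] <;> decide
  · refine secantsSix.exists_matrix {1, 2, 3} ∅ (fun i => ?_) (fun i => ?_) rfl <;>
      fin_cases i <;> norm_num [secantsSix] <;> decide
  · refine secantsSeven.exists_matrix {0, 1, 2} {0} (fun i => ?_) (fun i => ?_) rfl <;>
      fin_cases i <;> norm_num [secantsSeven] <;> decide
  · refine secantsEight.exists_matrix {0, 2, 3} {0, 1} (fun i => ?_) (fun i => ?_) rfl <;>
      fin_cases i <;> norm_num [secantsEight] <;> decide
  · refine secantsNine.exists_matrix {0, 1, 2, 3} {1} (fun i => ?_) (fun i => ?_) rfl <;>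
      fin_cases i <;> norm_num [secantsNine] <;> decide
  · refine secantsTen.exists_matrix {0, 1, 2, 3} {0, 1} (fun i => ?_) (fun i => ?_) rfl <;>
      fin_cases i <;> norm_num [secantsTen] <;> decide
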